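/- Fix an integer e ≥ 2 and κ = (κ₁, κ₂) ∈ (ℤ/eℤ)². Suppose λ is a bicore such that γ_x(λ) − γ_y(λ) ≤ 2 for all x, y ∈ ℤ/eℤ (computed with respect to any bicharge for κ). Let X = {x ∈ ℤ/eℤ : γ_x(λ) − γ_y(λ) = 2 for some y ∈ ℤ/eℤ} and Y = {y ∈ ℤ/eℤ : γ_x(λ) − γ_y(λ) = 2 for some x ∈ ℤ/eℤ}. Then wt(λ) = min{|X|, |Y|}. -/

import Mathlib

namespace Wt3

/-- `f : ℕ → ℕ` (0-indexed: `f r` is the `(r+1)`-th part `λ_{r+1}`) is a partition if it is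
weakly decreasing with finitely many nonzero terms. -/
def IsPartition (f : ℕ → ℕ) : Prop :=
  (∀ r, f (r + 1) ≤ f r) ∧ ∃ N, ∀ r, N ≤ r → f r = 0

/-- A bipartition: an ordered pair of partitions, given as `lam : Fin 2 → ℕ → ℕ`. -/
def IsBipartition (lam : Fin 2 → ℕ → ℕ) : Prop := ∀ a, IsPartition (lam a)

/-- Nodes `(r, c, a)` with 0-indexed row `r`, column `c`, and component `a : Fin 2`. -/
abbrev Node := ℕ × ℕ × Fin 2

/-- The Young diagram of a bipartition: `(r,c,a)` is a node iff `c < λ⁽ᵃ⁾_r` (0-indexed,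
corresponding to `c+1 ≤ λ⁽ᵃ⁾_{r+1}` in 1-indexed terms). -/
def Diagram (lam : Fin 2 → ℕ → ℕ) : Set Node := {x | x.2.1 < lam x.2.2 x.1}

/-- A node of `[λ]` is removable if deleting it leaves the Young diagram of a bipartition. -/
def IsRemovable (lam : Fin 2 → ℕ → ℕ) (x : Node) : Prop :=
  x ∈ Diagram lam ∧ ∃ mu, IsBipartition mu ∧ Diagram mu = Diagram lam \ {x}

/-- A node not in `[λ]` is addable if adding it gives the Young diagram of a bipartition. -/
def IsAddable (lam : Fin 2 → ℕ → ℕ) (x : Node) : Prop :=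
  x ∉ Diagram lam ∧ ∃ mu, IsBipartition mu ∧ Diagram mu = Diagram lam ∪ {x}

/-- The residue `c − r + κ_a ∈ ℤ/eℤ` of a node `(r,c,a)` (0-indexing leaves this unchanged). -/
def res (e : ℕ) (κ : Fin 2 → ZMod e) (x : Node) : ZMod e :=
  (x.2.1 : ZMod e) - (x.1 : ZMod e) + κ x.2.2

/-- `c_i(λ)`: the number of `i`-nodes of `λ`. -/
noncomputable def cnt (e : ℕ) (κ : Fin 2 → ZMod e) (lam : Fin 2 → ℕ → ℕ) (i : ZMod e) : ℕ :=
  Set.ncard {x : Node | x ∈ Diagram lam ∧ res e κ x = i}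

/-- The number of removable `i`-nodes of `λ`. -/
noncomputable def remCount (e : ℕ) (κ : Fin 2 → ZMod e) (lam : Fin 2 → ℕ → ℕ) (i : ZMod e) : ℕ :=
  Set.ncard {x : Node | IsRemovable lam x ∧ res e κ x = i}

/-- The number of addable `i`-nodes of `λ`. -/
noncomputable def addCount (e : ℕ) (κ : Fin 2 → ZMod e) (lam : Fin 2 → ℕ → ℕ) (i : ZMod e) : ℕ :=
  Set.ncard {x : Node | IsAddable lam x ∧ res e κ x = i}

/-- `δ_i(λ)`: number of removable `i`-nodes minus number of addable `i`-nodes. -/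
noncomputable def delta (e : ℕ) (κ : Fin 2 → ZMod e) (lam : Fin 2 → ℕ → ℕ) (i : ZMod e) : ℤ :=
  (remCount e κ lam i : ℤ) - (addCount e κ lam i : ℤ)

/-- The weight `wt(λ) = c_{κ₁}(λ) + c_{κ₂}(λ) − ½ Σ_{i ∈ ℤ/eℤ} (c_i(λ) − c_{i+1}(λ))²`. -/
noncomputable def wt (e : ℕ) (κ : Fin 2 → ZMod e) (lam : Fin 2 → ℕ → ℕ) : ℚ :=
  (cnt e κ lam (κ 0) : ℚ) + (cnt e κ lam (κ 1) : ℚ) -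
    (1 / 2) * ∑ j ∈ Finset.range e,
      ((cnt e κ lam (j : ZMod e) : ℚ) - (cnt e κ lam ((j : ZMod e) + 1) : ℚ)) ^ 2

/-- The rim of `λ`: nodes `(r,c,a) ∈ [λ]` with `(r+1,c+1,a) ∉ [λ]`. -/
def Rim (lam : Fin 2 → ℕ → ℕ) : Set Node :=
  {x | x ∈ Diagram lam ∧ (x.1 + 1, x.2.1 + 1, x.2.2) ∉ Diagram lam}

/-- One step along a strip: `y` is one step to the right of, or one step above, `x`
(in the same component). -/
def Step (x y : Node) : Prop :=
  y.2.2 = x.2.2 ∧ ((y.1 = x.1 ∧ y.2.1 = x.2.1 + 1) ∨ (x.1 = y.1 + 1 ∧ y.2.1 = x.2.1))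

/-- A rim hook of `λ`: a nonempty subset of the rim, contained in a single component,
forming a connected strip, whose removal leaves the Young diagram of a bipartition. -/
def IsRimHook (lam : Fin 2 → ℕ → ℕ) (H : Finset Node) : Prop :=
  H.Nonempty ∧ ↑H ⊆ Rim lam ∧ (∀ x ∈ H, ∀ y ∈ H, x.2.2 = y.2.2) ∧
    (∃ l : List Node, l.Chain' Step ∧ ∀ x : Node, x ∈ l ↔ x ∈ H) ∧
    ∃ mu, IsBipartition mu ∧ Diagram mu = Diagram lam \ ↑H

/-- A bicore: a bipartition with no rim `e`-hooks. -/
def IsBicore (e : ℕ) (lam : Fin 2 → ℕ → ℕ) : Prop :=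
  ¬ ∃ H : Finset Node, IsRimHook lam H ∧ H.card = e

/-- The beta-set `{λ_r + k − r : 1 ≤ r ≤ k}` of a partition with charge `k` (0-indexed form). -/
def betaSet (f : ℕ → ℕ) (k : ℕ) : Finset ℕ :=
  (Finset.range k).image fun r => f r + (k - (r + 1))

/-- The number of nonzero parts of a partition. -/
noncomputable def len (f : ℕ → ℕ) : ℕ := Set.ncard {r : ℕ | f r ≠ 0}

/-- `(k₁,k₂)` is a bicharge for `κ` relative to `λ`. -/
def IsBicharge (e : ℕ) (κ : Fin 2 → ZMod e) (lam : Fin 2 → ℕ → ℕ) (k₁ k₂ : ℕ) : Prop :=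
  (k₁ : ZMod e) = κ 0 ∧ (k₂ : ZMod e) = κ 1 ∧ len (lam 0) ≤ k₁ ∧ len (lam 1) ≤ k₂

/-- `γ_x(λ)`: beads of residue `x` in the first beta-set minus those in the second. -/
def gamma (e : ℕ) (lam : Fin 2 → ℕ → ℕ) (k₁ k₂ : ℕ) (x : ZMod e) : ℤ :=
  (((betaSet (lam 0) k₁).filter fun b : ℕ => (b : ZMod e) = x).card : ℤ) -
    (((betaSet (lam 1) k₂).filter fun b : ℕ => (b : ZMod e) = x).card : ℤ)

/-- `x` is above (higher than) `y`. -/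
def Above (x y : Node) : Prop := x.2.2 < y.2.2 ∨ (x.2.2 = y.2.2 ∧ x.1 < y.1)

/-- A normal `i`-node: a removable `i`-node `x` such that for every addable `i`-node `y`
below `x`, the removable `i`-nodes strictly between `x` and `y` outnumber the addable ones
(equivalently, the `−` sign of `x` survives in the reduced `i`-signature). -/
def IsNormal (e : ℕ) (κ : Fin 2 → ZMod e) (lam : Fin 2 → ℕ → ℕ) (i : ZMod e) (x : Node) :
    Prop :=
  IsRemovable lam x ∧ res e κ x = i ∧
    ∀ y : Node, IsAddable lam y → res e κ y = i → Above x y →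
      Set.ncard {z : Node | IsAddable lam z ∧ res e κ z = i ∧ Above x z ∧ Above z y} <
        Set.ncard {z : Node | IsRemovable lam z ∧ res e κ z = i ∧ Above x z ∧ Above z y}

/-- The good `i`-node: the highest normal `i`-node. -/
def IsGood (e : ℕ) (κ : Fin 2 → ZMod e) (lam : Fin 2 → ℕ → ℕ) (i : ZMod e) (x : Node) :
    Prop :=
  IsNormal e κ lam i x ∧ ∀ y, IsNormal e κ lam i y → y = x ∨ Above x y

/-- An antinormal `i`-node: a removable `i`-node `x` such that for every addable `i`-node `y`
above `x`, the removable `i`-nodes strictly between `y` and `x` outnumber the addable ones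
(equivalently, the `−` sign of `x` survives in the antireduced `i`-signature). -/
def IsAntinormal (e : ℕ) (κ : Fin 2 → ZMod e) (lam : Fin 2 → ℕ → ℕ) (i : ZMod e) (x : Node) :
    Prop :=
  IsRemovable lam x ∧ res e κ x = i ∧
    ∀ y : Node, IsAddable lam y → res e κ y = i → Above y x →
      Set.ncard {z : Node | IsAddable lam z ∧ res e κ z = i ∧ Above y z ∧ Above z x} <
        Set.ncard {z : Node | IsRemovable lam z ∧ res e κ z = i ∧ Above y z ∧ Above z x}

/-- The antigood `i`-node: the lowest antinormal `i`-node. -/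
def IsAntigood (e : ℕ) (κ : Fin 2 → ZMod e) (lam : Fin 2 → ℕ → ℕ) (i : ZMod e) (x : Node) :
    Prop :=
  IsAntinormal e κ lam i x ∧ ∀ y, IsAntinormal e κ lam i y → y = x ∨ Above y x

/-- `μ →ᵢ λ`: `μ` is obtained from `λ` by removing the good `i`-node. -/
def RemGoodAt (e : ℕ) (κ : Fin 2 → ZMod e) (i : ZMod e) (mu lam : Fin 2 → ℕ → ℕ) : Prop :=
  ∃ x, IsGood e κ lam i x ∧ Diagram mu = Diagram lam \ {x}

/-- `μ ⇒ᵢ λ`: `μ` is obtained from `λ` by removing the antigood `i`-node. -/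
def RemAntigoodAt (e : ℕ) (κ : Fin 2 → ZMod e) (i : ZMod e) (mu lam : Fin 2 → ℕ → ℕ) : Prop :=
  ∃ x, IsAntigood e κ lam i x ∧ Diagram mu = Diagram lam \ {x}

/-- `μ → λ`: `μ` is obtained from the bipartition `λ` by removing a good node. -/
def RemGood (e : ℕ) (κ : Fin 2 → ZMod e) (mu lam : Fin 2 → ℕ → ℕ) : Prop :=
  IsBipartition mu ∧ IsBipartition lam ∧ ∃ i, RemGoodAt e κ i mu lam

/-- A bipartition is restricted if it lies in the class of the empty bipartition under the
equivalence relation generated by `→`. -/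
def IsRestricted (e : ℕ) (κ : Fin 2 → ZMod e) (lam : Fin 2 → ℕ → ℕ) : Prop :=
  Relation.EqvGen (RemGood e κ) lam (fun _ _ => 0)

/-- A partition is `e`-restricted if `λ_r − λ_{r+1} < e` for all `r`. -/
def IsERestricted (e : ℕ) (f : ℕ → ℕ) : Prop := ∀ r, f r < f (r + 1) + e

/-- The conjugate partition: `λ′_r = #{c : λ_c ≥ r}` (0-indexed form). -/
noncomputable def conjP (f : ℕ → ℕ) : ℕ → ℕ := fun r => Set.ncard {c : ℕ | r + 1 ≤ f c}

/-- The conjugate bipartition `λ′ = ((λ⁽²⁾)′ | (λ⁽¹⁾)′)`. -/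
noncomputable def conjB (lam : Fin 2 → ℕ → ℕ) : Fin 2 → ℕ → ℕ := fun a => conjP (lam (1 - a))

/-- `|λ|` for a partition. -/
noncomputable def psize (f : ℕ → ℕ) : ℕ := Set.ncard {p : ℕ × ℕ | p.2 < f p.1}

/-- `|λ|` for a bipartition. -/
noncomputable def bsize (lam : Fin 2 → ℕ → ℕ) : ℕ := psize (lam 0) + psize (lam 1)

/-- `λ_1 + ⋯ + λ_r`. -/
def psum (f : ℕ → ℕ) (r : ℕ) : ℕ := ∑ j ∈ Finset.range r, f j

/-- The dominance order on bipartitions: `λ ⊵ μ`. -/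
def Dominates (lam mu : Fin 2 → ℕ → ℕ) : Prop :=
  ∀ r : ℕ, psum (mu 0) r ≤ psum (lam 0) r ∧
    psize (mu 0) + psum (mu 1) r ≤ psize (lam 0) + psum (lam 1) r

/-! Single-partition versions (for statement 11). -/

abbrev Node1 := ℕ × ℕ

def Diagram1 (f : ℕ → ℕ) : Set Node1 := {x | x.2 < f x.1}

def IsRemovable1 (f : ℕ → ℕ) (x : Node1) : Prop :=
  x ∈ Diagram1 f ∧ ∃ g, IsPartition g ∧ Diagram1 g = Diagram1 f \ {x}

def IsAddable1 (f : ℕ → ℕ) (x : Node1) : Prop :=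
  x ∉ Diagram1 f ∧ ∃ g, IsPartition g ∧ Diagram1 g = Diagram1 f ∪ {x}

def res1 (e : ℕ) (k : ZMod e) (x : Node1) : ZMod e := (x.2 : ZMod e) - (x.1 : ZMod e) + k

def Rim1 (f : ℕ → ℕ) : Set Node1 := {x | x ∈ Diagram1 f ∧ (x.1 + 1, x.2 + 1) ∉ Diagram1 f}

def Step1 (x y : Node1) : Prop :=
  (y.1 = x.1 ∧ y.2 = x.2 + 1) ∨ (x.1 = y.1 + 1 ∧ y.2 = x.2)

def IsRimHook1 (f : ℕ → ℕ) (H : Finset Node1) : Prop :=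
  H.Nonempty ∧ ↑H ⊆ Rim1 f ∧
    (∃ l : List Node1, l.Chain' Step1 ∧ ∀ x : Node1, x ∈ l ↔ x ∈ H) ∧
    ∃ g, IsPartition g ∧ Diagram1 g = Diagram1 f \ ↑H

/-- An `e`-core: a partition with no rim `e`-hooks. -/
def IsECore (e : ℕ) (f : ℕ → ℕ) : Prop := ¬ ∃ H : Finset Node1, IsRimHook1 f H ∧ H.card = e

/-! The statement. -/
theorem IsPartition.antitone {f : ℕ → ℕ} (hf : IsPartition f) : Antitone f :=
  antitone_nat_of_succ_le hf.1

/-- If `t` is not of the form `f j - j`, each content `n` with `t ≤ n < f r - r` is the content of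
a rim node in row `r` or below. -/
theorem IsPartition.exists_rim_node {f : ℕ → ℕ} (hf : IsPartition f) {t n : ℤ} {r : ℕ}
    (ht : ∀ j : ℕ, (f j : ℤ) - j ≠ t) (htn : t ≤ n) (hn : n < f r - r) :
    ∃ j c : ℕ, (c : ℤ) - j = n ∧ r ≤ j ∧ c < f j ∧ f (j + 1) ≤ c + 1 := by
  have hex : ∃ j : ℕ, (f j : ℤ) - j ≤ n := by
    obtain ⟨N, hN⟩ := hf.2
    refine ⟨max N (-n).toNat, ?_⟩
    rw [hN _ (le_max_left _ _)]
    have := le_max_right N (-n).toNat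
    omega
  obtain ⟨m, hm, hmin⟩ : ∃ m : ℕ, (f m : ℤ) - m ≤ n ∧ ∀ i < m, n < (f i : ℤ) - i := by
    classical
    exact ⟨Nat.find hex, Nat.find_spec hex, fun i hi => not_le.1 (Nat.find_min hex hi)⟩
  have hrm : r < m := by
    by_contra! h
    have := hf.antitone h
    omega
  obtain ⟨j, rfl⟩ : ∃ j, m = j + 1 := ⟨m - 1, by omega⟩
  have hj := hmin j (by omega)
  have hnonneg : 0 ≤ n + j := by
    by_contra! h
    have h1 := ht (-t).toNat
    have h2 : f (-t).toNat ≤ f (j + 1) := hf.antitone (by omega)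
    omega
  refine ⟨j, (n + j).toNat, ?_, ?_, ?_, ?_⟩ <;> omega

/-- A bead that can be moved up `e` places gives a rim `e`-hook. -/
theorem exists_isRimHook {lam : Fin 2 → ℕ → ℕ} (hlam : IsBipartition lam) (a : Fin 2) (r e : ℕ)
    (he : 0 < e) (h : ∀ j : ℕ, (lam a j : ℤ) - j ≠ lam a r - r - e) :
    ∃ H : Finset Node, IsRimHook lam H ∧ H.card = e := by
  have hf := hlam a
  have hex : ∀ i : ℕ, ∃ p : ℕ × ℕ, i < e → ((p.2 : ℤ) - p.1 = lam a r - r - e + i ∧ r ≤ p.1 ∧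
      p.2 < lam a p.1 ∧ lam a (p.1 + 1) ≤ p.2 + 1) := by
    intro i
    by_cases hi : i < e
    · obtain ⟨j, c, hjc⟩ := hf.exists_rim_node (n := lam a r - r - e + i) (r := r) h
        (by omega) (by omega)
      exact ⟨(j, c), fun _ => hjc⟩
    · exact ⟨(0, 0), fun h => absurd h hi⟩
  choose p hp using hex
  let node : ℕ → Node := fun i => ((p i).1, (p i).2, a)
  have hinj : Set.InjOn node (Finset.range e : Set ℕ) := by
    intro i hi j hj hij
    simp only [node, Prod.mk.injEq] at hij
    have h1 := (hp i (by simpa using hi)).1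
    have h2 := (hp j (by simpa using hj)).1
    omega
  have hmem : ∀ x : Node, x ∈ (Finset.range e).image node ↔ x.2.2 = a ∧
      (lam a r : ℤ) - r - e ≤ x.2.1 - x.1 ∧ r ≤ x.1 ∧ x.2.1 < lam a x.1 ∧
        lam a (x.1 + 1) ≤ x.2.1 + 1 := by
    rintro ⟨j, c, b⟩
    simp only [Finset.mem_image, Finset.mem_range, node, Prod.mk.injEq]
    constructor
    · rintro ⟨i, hi, rfl, rfl, rfl⟩
      obtain ⟨h1, h2, h3, h4⟩ := hp i hi
      exact ⟨rfl, by omega, h2, h3, h4⟩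
    · rintro ⟨rfl, h1, h2, h3, h4⟩
      have hjr := hf.antitone h2
      obtain ⟨i, hi⟩ : ∃ i : ℕ, (i : ℤ) = c - j - (lam b r - r - e) :=
        ⟨_, Int.toNat_of_nonneg (by omega)⟩
      have hie : i < e := by omega
      obtain ⟨g1, g2, g3, g4⟩ := hp i hie
      refine ⟨i, hie, ?_, ?_, rfl⟩
      all_goals
        generalize p i = q at g1 g2 g3 g4 ⊢
        rcases lt_trichotomy q.1 j with hlt | heq | hlt
        · have := hf.antitone (show q.1 + 1 ≤ j from hlt)
          omega
        · rw [heq] at g1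
          omega
        · have := hf.antitone (show j + 1 ≤ q.1 from hlt)
          omega
  refine ⟨(Finset.range e).image node, ⟨?_, ?_, ?_, ?_, ?_⟩, ?_⟩
  · exact (Finset.nonempty_range_iff.2 he.ne').image _
  · rintro ⟨j, c, b⟩ hx
    obtain ⟨rfl, h1, h2, h3, h4⟩ := (hmem _).1 (Finset.mem_coe.1 hx)
    exact ⟨h3, fun h5 => absurd (show c + 1 < lam b (j + 1) from h5) (not_lt.2 h4)⟩
  · intro x hx y hy
    rw [((hmem _).1 hx).1, ((hmem _).1 hy).1]
  · refine ⟨(List.range e).map node, ?_, fun x => by simp⟩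
    refine (List.isChain_map node).2 ((List.isChain_range _ _).2 fun i hi => ⟨rfl, ?_⟩)
    obtain ⟨g1, g2, g3, g4⟩ := hp i (by omega)
    obtain ⟨k1, k2, k3, k4⟩ := hp (i + 1) (by omega)
    simp only [node, Nat.succ_eq_add_one]
    generalize p i = q at *
    generalize p (i + 1) = s at *
    rcases lt_trichotomy q.1 s.1 with hlt | heq | hlt
    · have := hf.antitone (show q.1 + 1 ≤ s.1 from hlt)
      omega
    · omega
    · have h1 := hf.antitone (show s.1 + 1 ≤ q.1 from hlt)
      rcases (show s.1 + 1 ≤ q.1 from hlt).lt_or_eq with h2 | h2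
      · have := hf.antitone (show s.1 + 1 ≤ q.1 - 1 by omega)
        have := hf.antitone (show q.1 - 1 ≤ q.1 by omega)
        omega
      · omega
  · let g : ℕ → ℕ := fun j => if j < r then lam a j else
      min (lam a j) (max ((lam a r : ℤ) - r - e + j) (lam a (j + 1) - 1)).toNat
    have hg : ∀ j c, c < g j ↔ c < lam a j ∧ (j < r ∨ (c : ℤ) - j < (lam a r : ℤ) - r - e ∨
        c + 1 < lam a (j + 1)) := by
      intro j c
      simp only [g]
      split_ifs with hj <;> omega
    refine ⟨Function.update lam a g, ?_, ?_⟩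
    · intro b
      by_cases hb : b = a
      · subst hb
        rw [Function.update_self]
        refine ⟨fun j => ?_, ?_⟩
        · have h1 := hf.1 j
          have h2 := hf.1 (j + 1)
          have h3 := h (j + 1)
          simp only [g]
          split_ifs <;> omega
        · obtain ⟨N, hN⟩ := hf.2
          refine ⟨N, fun j hj => ?_⟩
          have := hN j hj
          simp only [g]
          split_ifs <;> omega
      · rw [Function.update_of_ne hb]
        exact hlam b
    · ext ⟨j, c, b⟩
      rw [Set.mem_sdiff, Finset.mem_coe, hmem]
      simp only [Diagram, Set.mem_ofPred_eq]
      by_cases hb : b = a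
      · subst hb
        rw [Function.update_self, hg]
        omega
      · rw [Function.update_of_ne hb]
        simp [hb]
  · rw [Finset.card_image_of_injOn hinj, Finset.card_range]

theorem eq_zero_of_len_le {f : ℕ → ℕ} (hf : IsPartition f) {k : ℕ} (hk : len f ≤ k) {r : ℕ}
    (hr : k ≤ r) : f r = 0 := by
  by_contra h
  obtain ⟨N, hN⟩ := hf.2
  have hfin : {r : ℕ | f r ≠ 0}.Finite :=
    (Set.finite_Iio N).subset fun j hj => not_le.1 fun h => hj (hN j h)
  have hsub : (Finset.range (r + 1) : Set ℕ) ⊆ {r : ℕ | f r ≠ 0} := by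
    intro j hj
    have := hf.antitone (show j ≤ r by simp at hj; omega)
    simp only [Set.mem_ofPred_eq]
    omega
  have := Set.ncard_le_ncard hsub hfin
  rw [Set.ncard_coe_finset, Finset.card_range] at this
  unfold len at hk
  omega

theorem betaSet_injOn {f : ℕ → ℕ} (hf : IsPartition f) (k : ℕ) :
    Set.InjOn (fun r => f r + (k - (r + 1))) (Finset.range k : Set ℕ) := by
  intro i hi j hj hij
  simp only [Finset.coe_range, Set.mem_Iio] at hi hj hij
  rcases lt_trichotomy i j with hlt | heq | hlt
  · have := hf.antitone hlt.le
    omega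
  · exact heq
  · have := hf.antitone hlt.le
    omega

/-- In a bicore every bead of a beta-set has been pushed up as far as possible. -/
theorem sub_mem_betaSet {e : ℕ} (he : 0 < e) {lam : Fin 2 → ℕ → ℕ} (hlam : IsBipartition lam)
    (hcore : IsBicore e lam) (a : Fin 2) {k : ℕ} (hk : len (lam a) ≤ k) {b : ℕ}
    (hb : b ∈ betaSet (lam a) k) (heb : e ≤ b) : b - e ∈ betaSet (lam a) k := by
  by_contra hnot
  simp only [betaSet, Finset.mem_image, Finset.mem_range, not_exists, not_and] at hb hnot
  obtain ⟨r, hr, rfl⟩ := hb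
  refine hcore (exists_isRimHook hlam a r e he fun j hj => ?_)
  by_cases hjk : j < k
  · have := hnot j hjk
    omega
  · have := eq_zero_of_len_le (hlam a) hk (not_lt.1 hjk)
    omega

/-- The number of elements of `S` of residue `x` modulo `e`. -/
def resCard (e : ℕ) (S : Finset ℕ) (x : ZMod e) : ℕ :=
  (S.filter fun b : ℕ => (b : ZMod e) = x).card

theorem sum_resCard (e : ℕ) [NeZero e] (S : Finset ℕ) : ∑ x, resCard e S x = S.card := by
  simpa [resCard] using
    (Finset.card_eq_sum_card_fiberwise (f := fun b : ℕ => (b : ZMod e)) (s := S)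
      (t := Finset.univ) (fun _ _ => Finset.mem_coe.2 (Finset.mem_univ _))).symm

theorem count_natCast_eq (e : ℕ) [NeZero e] (x : ZMod e) (t : ℕ) :
    t.count (fun n : ℕ => (n : ZMod e) = x) = t / e + if x.val < t % e then 1 else 0 := by
  have h := Nat.count_modEq_card t (NeZero.pos e) x.val
  rw [Nat.mod_eq_of_lt x.val_lt] at h
  rw [← h]
  congr 1
  ext n
  rw [← ZMod.natCast_eq_natCast_iff, ZMod.natCast_zmod_val]

theorem resCard_range (e : ℕ) (x : ZMod e) (t : ℕ) :
    resCard e (Finset.range t) x = t.count fun n : ℕ => (n : ZMod e) = x :=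
  (Nat.count_eq_card_filter_range _ _).symm

theorem card_filter_row {e : ℕ} (L r K : ℕ) (hr : r < K) (i : ZMod e) :
    ((((Finset.range L).filter fun c : ℕ => (c : ZMod e) - r + K = i).card : ℕ) : ℤ) =
      (L + (K - (r + 1)) + 1).count (fun n : ℕ => (n : ZMod e) = i) -
        (K - 1 - r + 1).count (fun n : ℕ => (n : ZMod e) = i) := by
  have h1 : L + (K - (r + 1)) + 1 = (K - r) + L := by omega
  have h2 : K - 1 - r + 1 = K - r := by omega
  rw [h1, h2, Nat.count_add, Nat.count_eq_card_filter_range _ L]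
  push_cast [hr.le]
  rw [add_sub_cancel_left]
  congr 3
  ext c
  rw [show (c : ZMod e) - r + K = K - r + c by ring]

theorem cnt_eq {e : ℕ} {κ : Fin 2 → ZMod e} {lam : Fin 2 → ℕ → ℕ} (hlam : IsBipartition lam)
    {k : Fin 2 → ℕ} (hκ : ∀ a, (k a : ZMod e) = κ a) (hk : ∀ a, len (lam a) ≤ k a)
    (i : ZMod e) :
    (cnt e κ lam i : ℤ) =
      ∑ a, (∑ b ∈ betaSet (lam a) (k a), ((b + 1).count (fun n : ℕ => (n : ZMod e) = i) : ℤ) -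
        ∑ j ∈ Finset.range (k a), ((j + 1).count (fun n : ℕ => (n : ZMod e) = i) : ℤ)) := by
  let T : Finset (Σ _ : Fin 2, Σ _ : ℕ, ℕ) := Finset.univ.sigma fun a =>
    (Finset.range (k a)).sigma fun r =>
      (Finset.range (lam a r)).filter fun c : ℕ => (c : ZMod e) - r + k a = i
  have hT : {x : Node | x ∈ Diagram lam ∧ res e κ x = i} =
      (T.image fun p => ((p.2.1, p.2.2, p.1) : Node) : Finset Node) := by
    ext ⟨r, c, a⟩
    simp only [Set.mem_ofPred_eq, Diagram, res, Finset.coe_image, Set.mem_image, Finset.mem_coe]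
    constructor
    · rintro ⟨h1, h2⟩
      refine ⟨⟨a, r, c⟩, ?_, rfl⟩
      have hr : r < k a := by
        by_contra! h
        have := eq_zero_of_len_le (hlam a) (hk a) h
        omega
      simp [T, hr, h1, hκ, h2]
    · rintro ⟨⟨a', r', c'⟩, h, heq⟩
      simp only [Prod.mk.injEq] at heq
      obtain ⟨rfl, rfl, rfl⟩ := heq
      simp only [T, Finset.mem_sigma, Finset.mem_filter, Finset.mem_range, hκ] at h
      exact ⟨h.2.2.1, h.2.2.2⟩
  have hcard : cnt e κ lam i = T.card := by
    rw [cnt, hT, Set.ncard_coe_finset, Finset.card_image_of_injective]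
    rintro ⟨a, r, c⟩ ⟨a', r', c'⟩ h
    simp only [Prod.mk.injEq] at h
    obtain ⟨rfl, rfl, rfl⟩ := h
    rfl
  rw [hcard, Finset.card_sigma]
  push_cast
  refine Finset.sum_congr rfl fun a _ => ?_
  rw [Finset.card_sigma, betaSet, Finset.sum_image (betaSet_injOn (hlam a) (k a)),
    
    ← Finset.sum_range_reflect
      (fun j => ((j + 1).count (fun n : ℕ => (n : ZMod e) = i) : ℤ)) (k a), ← Finset.sum_sub_distrib]
  push_cast
  exact Finset.sum_congr rfl fun r hr => card_filter_row _ _ _ (Finset.mem_range.1 hr) i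

/-- Crossing from residue `i` to `i + 1` changes the number of smaller naturals only at `t` and
at `-1`. -/
theorem count_succ_sub_count_succ {e : ℕ} (i : ZMod e) (t : ℕ) :
    ((t + 1).count (fun n : ℕ => (n : ZMod e) = i) : ℤ) -
      (t + 1).count (fun n : ℕ => (n : ZMod e) = i + 1) =
      (if (t : ZMod e) = i then 1 else 0) - if (0 : ZMod e) = i + 1 then 1 else 0 := by
  induction t with
  | zero => simp [Nat.count_succ]
  | succ t ih =>
    rw [Nat.count_succ, Nat.count_succ _ (t + 1)]
    push_cast at ih ⊢
    simp only [add_left_inj]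
    linarith

theorem sum_count_sub_sum_count {e : ℕ} (S : Finset ℕ) (i : ZMod e) :
    ∑ b ∈ S, ((b + 1).count (fun n : ℕ => (n : ZMod e) = i) : ℤ) -
      ∑ b ∈ S, ((b + 1).count (fun n : ℕ => (n : ZMod e) = i + 1) : ℤ) =
      resCard e S i - S.card * if (0 : ZMod e) = i + 1 then 1 else 0 := by
  rw [← Finset.sum_sub_distrib, Finset.sum_congr rfl fun b _ => count_succ_sub_count_succ i b,
    Finset.sum_sub_distrib, resCard, Finset.card_filter]
  simp

theorem eq_range_card_of_lower {S : Finset ℕ} (h : ∀ m, m + 1 ∈ S → m ∈ S) :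
    S = Finset.range S.card := by
  have hlow : ∀ m ∈ S, ∀ n ≤ m, n ∈ S := by
    intro m hm n hn
    induction hn using Nat.decreasingInduction with
    | self => exact hm
    | of_succ n _ ih => exact h n ih
  refine Finset.eq_of_subset_of_card_le (fun m hm => ?_) (by simp)
  have : Finset.range (m + 1) ⊆ S := fun n hn => hlow m hm n (by simp at hn; omega)
  simpa using Finset.card_le_card this

theorem sum_div_filter_residue {e : ℕ} [NeZero e] {S : Finset ℕ}
    (hS : ∀ b ∈ S, e ≤ b → b - e ∈ S) (x : ZMod e) :
    2 * ∑ b ∈ S.filter (fun b : ℕ => (b : ZMod e) = x), ((b / e : ℕ) : ℤ) =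
      (resCard e S x : ℤ) ^ 2 - resCard e S x := by
  have he := NeZero.pos e
  have hinj : Set.InjOn (fun b => b / e) (S.filter fun b : ℕ => (b : ZMod e) = x : Set ℕ) := by
    intro b hb c hc h
    simp only [Finset.coe_filter, Set.mem_ofPred_eq] at hb hc
    have h1 : b % e = c % e := (ZMod.natCast_eq_natCast_iff' b c e).1 (hb.2.trans hc.2.symm)
    rw [← Nat.div_add_mod b e, ← Nat.div_add_mod c e, h1]
    simp only at h
    rw [h]
  have hlow : (S.filter fun b : ℕ => (b : ZMod e) = x).image (fun b => b / e) =
      Finset.range (resCard e S x) := by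
    rw [resCard, ← Finset.card_image_of_injOn hinj]
    refine eq_range_card_of_lower fun m hm => ?_
    simp only [Finset.mem_image, Finset.mem_filter] at hm ⊢
    obtain ⟨b, ⟨hb, hx⟩, hbm⟩ := hm
    have heb : e ≤ b := by
      by_contra! h
      rw [Nat.div_eq_of_lt h] at hbm
      omega
    refine ⟨b - e, ⟨hS b hb heb, ?_⟩, ?_⟩
    · rw [Nat.cast_sub heb, hx, ZMod.natCast_self, sub_zero]
    · have := Nat.div_eq_sub_div he heb
      omega
  rw [← Finset.sum_image (f := fun m : ℕ => (m : ℤ)) hinj, hlow]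
  have h := Finset.sum_range_id_mul_two (resCard e S x)
  rcases Nat.eq_zero_or_pos (resCard e S x) with h0 | h0
  · simp [h0]
  · zify [h0] at h
    linarith

theorem two_mul_sum_count {e : ℕ} [NeZero e] {S : Finset ℕ}
    (hS : ∀ b ∈ S, e ≤ b → b - e ∈ S) (k : ℕ) :
    2 * ∑ b ∈ S, ((b + 1).count (fun n : ℕ => (n : ZMod e) = k) : ℤ) =
      ∑ x, ((resCard e S x : ℤ) ^ 2 - 2 * resCard e S x * resCard e (Finset.range k) x) +
        (2 * (k / e : ℕ) + 1) * S.card := by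
  have hb : ∀ b : ℕ, ((b + 1).count (fun n : ℕ => (n : ZMod e) = k) : ℤ) =
      (b / e : ℕ) + (1 - resCard e (Finset.range k) (b : ZMod e) + (k / e : ℕ)) := by
    intro b
    rw [resCard_range, Nat.count_succ, count_natCast_eq, count_natCast_eq, ZMod.val_natCast,
      ZMod.val_natCast]
    have : ((b : ZMod e) = k) ↔ b % e = k % e := ZMod.natCast_eq_natCast_iff' b k e
    simp only [this]
    push_cast
    split_ifs <;> omega
  rw [← sum_resCard e S, ← Finset.sum_fiberwise S (fun b : ℕ => (b : ZMod e)), Finset.mul_sum]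
  push_cast
  rw [Finset.mul_sum, ← Finset.sum_add_distrib]
  refine Finset.sum_congr rfl fun x _ => ?_
  rw [Finset.sum_congr rfl fun b _ => hb b, Finset.sum_add_distrib, mul_add,
    sum_div_filter_residue hS x]
  have : ∑ b ∈ S.filter (fun b : ℕ => (b : ZMod e) = x),
      (1 - (resCard e (Finset.range k) (b : ZMod e) : ℤ) + (k / e : ℕ)) =
      resCard e S x * (1 - (resCard e (Finset.range k) x : ℤ) + (k / e : ℕ)) := by
    rw [Finset.sum_congr rfl (g := fun _ => 1 - (resCard e (Finset.range k) x : ℤ) + (k / e : ℕ))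
      fun b hb => by rw [(Finset.mem_filter.1 hb).2], Finset.sum_const, nsmul_eq_mul]
    rfl
  rw [this]
  push_cast
  ring

theorem card_betaSet {f : ℕ → ℕ} (hf : IsPartition f) (k : ℕ) : (betaSet f k).card = k := by
  rw [betaSet, Finset.card_image_of_injOn (betaSet_injOn hf k), Finset.card_range]

theorem sum_range_natCast {e : ℕ} [NeZero e] {M : Type*} [AddCommMonoid M] (G : ZMod e → M) :
    ∑ j ∈ Finset.range e, G (j : ZMod e) = ∑ x, G x := by
  refine Finset.sum_nbij' (fun j => (j : ZMod e)) ZMod.val ?_ ?_ ?_ ?_ ?_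
  · simp
  · exact fun x _ => Finset.mem_range.2 x.val_lt
  · exact fun j hj => ZMod.val_cast_of_lt (Finset.mem_range.1 hj)
  · exact fun x _ => ZMod.natCast_zmod_val x
  · simp

section Weight

variable {e : ℕ} {κ : Fin 2 → ZMod e} {lam : Fin 2 → ℕ → ℕ} {k : Fin 2 → ℕ}

theorem cnt_sub_cnt_succ (hlam : IsBipartition lam)
    (hκ : ∀ a, (k a : ZMod e) = κ a) (hk : ∀ a, len (lam a) ≤ k a) (i : ZMod e) :
    (cnt e κ lam i : ℤ) - cnt e κ lam (i + 1) =
      ∑ a, ((resCard e (betaSet (lam a) (k a)) i : ℤ) - resCard e (Finset.range (k a)) i) := by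
  rw [cnt_eq hlam hκ hk, cnt_eq hlam hκ hk, ← Finset.sum_sub_distrib]
  refine Finset.sum_congr rfl fun a _ => ?_
  have h1 := sum_count_sub_sum_count (betaSet (lam a) (k a)) i
  have h2 := sum_count_sub_sum_count (Finset.range (k a)) i
  rw [card_betaSet (hlam a)] at h1
  rw [Finset.card_range] at h2
  linarith

theorem two_mul_cnt [NeZero e] (hlam : IsBipartition lam) (hcore : IsBicore e lam)
    (hκ : ∀ a, (k a : ZMod e) = κ a) (hk : ∀ a, len (lam a) ≤ k a) (l : ℕ) :
    2 * (cnt e κ lam l : ℤ) =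
      ∑ x, ∑ a, ((resCard e (betaSet (lam a) (k a)) x : ℤ) ^ 2 -
        resCard e (Finset.range (k a)) x ^ 2 -
        2 * (resCard e (betaSet (lam a) (k a)) x - resCard e (Finset.range (k a)) x) *
          resCard e (Finset.range l) x) := by
  rw [cnt_eq hlam hκ hk, Finset.sum_comm, Finset.mul_sum]
  refine Finset.sum_congr rfl fun a _ => ?_
  have h1 := two_mul_sum_count (e := e) (S := betaSet (lam a) (k a))
    (fun b hb => sub_mem_betaSet (NeZero.pos e) hlam hcore a (hk a) hb) l
  have h2 := two_mul_sum_count (e := e) (S := Finset.range (k a))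
    (fun b hb _ => Finset.mem_range.2 ((Nat.sub_le b e).trans_lt (Finset.mem_range.1 hb))) l
  rw [card_betaSet (hlam a)] at h1
  rw [Finset.card_range] at h2
  rw [mul_sub, h1, h2, add_sub_add_right_eq_sub, ← Finset.sum_sub_distrib]
  exact Finset.sum_congr rfl fun x _ => by ring

/-- The weight of a bicore in terms of the numbers of beads on the runners. -/
theorem two_mul_wt [NeZero e] (hlam : IsBipartition lam) (hcore : IsBicore e lam)
    (hκ : ∀ a, (k a : ZMod e) = κ a) (hk : ∀ a, len (lam a) ≤ k a) :
    2 * wt e κ lam = ((∑ x, (((resCard e (betaSet (lam 0) (k 0)) x : ℤ) -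
        resCard e (betaSet (lam 1) (k 1)) x) ^ 2 -
      ((resCard e (Finset.range (k 0)) x : ℤ) - resCard e (Finset.range (k 1)) x) ^ 2) : ℤ) :
        ℚ) := by
  have h : 2 * wt e κ lam = ((2 * (cnt e κ lam (k 0 : ℕ) : ℤ) + 2 * (cnt e κ lam (k 1 : ℕ) : ℤ) -
      ∑ x, ((cnt e κ lam x : ℤ) - cnt e κ lam (x + 1)) ^ 2 : ℤ) : ℚ) := by
    rw [wt, sum_range_natCast fun x => ((cnt e κ lam x : ℚ) - (cnt e κ lam (x + 1) : ℚ)) ^ 2,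
      hκ, hκ]
    push_cast
    ring
  rw [h, two_mul_cnt hlam hcore hκ hk, two_mul_cnt hlam hcore hκ hk, ← Finset.sum_add_distrib,
    ← Finset.sum_sub_distrib]
  congr 1
  refine Finset.sum_congr rfl fun x _ => ?_
  rw [cnt_sub_cnt_succ hlam hκ hk]
  simp only [Fin.sum_univ_two]
  ring

end Weight

section Balanced

variable {ι : Type*} [Fintype ι]

/-- An integer function whose values differ by at most one takes only the two values determined
by its mean. -/
theorem mul_eq_zero_of_sum_mem_Icc {d : ι → ℤ} (hd : ∀ x y, d x - d y ≤ 1) {n : ℤ}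
    (h0 : 0 ≤ ∑ x, (d x - n)) (h1 : ∑ x, (d x - (n + 1)) ≤ 0) (x : ι) :
    (d x - n) * (d x - n - 1) = 0 := by
  have hle : d x ≤ n + 1 := by
    by_contra! h
    have : 0 < ∑ y, (d y - (n + 1)) :=
      Finset.sum_pos' (fun y _ => by have := hd x y; omega) ⟨x, Finset.mem_univ x, by omega⟩
    omega
  have hge : n ≤ d x := by
    by_contra! h
    have : ∑ y, (d y - n) < 0 :=
      Finset.sum_neg' (fun y _ => by have := hd y x; omega) ⟨x, Finset.mem_univ x, by omega⟩
    omega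
  rcases hle.eq_or_lt with h | h
  · simp [h]
  · simp [show d x = n by omega]

theorem sum_sq_sub_sq_of_balanced {g d : ι → ℤ} (hd : ∀ x y, d x - d y ≤ 1)
    (hs : ∑ x, g x = ∑ x, d x) {n : ℤ} (h0 : 0 ≤ ∑ x, (g x - n))
    (h1 : ∑ x, (g x - (n + 1)) ≤ 0) :
    ∑ x, (g x ^ 2 - d x ^ 2) = ∑ x, (g x - n) * (g x - n - 1) := by
  have hshift : ∀ c : ℤ, ∑ x, (g x - c) = ∑ x, (d x - c) := fun c => by
    rw [Finset.sum_sub_distrib, Finset.sum_sub_distrib, hs]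
  rw [hshift] at h0 h1
  have key : ∑ x, (g x ^ 2 - d x ^ 2) - ∑ x, (g x - n) * (g x - n - 1) =
      (2 * n + 1) * (∑ x, g x - ∑ x, d x) - ∑ x, (d x - n) * (d x - n - 1) := by
    rw [← Finset.sum_sub_distrib, ← Finset.sum_sub_distrib, Finset.mul_sum,
      ← Finset.sum_sub_distrib]
    exact Finset.sum_congr rfl fun x _ => by ring
  rw [Finset.sum_eq_zero fun x _ => mul_eq_zero_of_sum_mem_Icc hd h0 h1 x, hs] at key
  linarith

theorem sum_sq_sub_sq_eq_two_mul_min {g d : ι → ℤ} {m : ℤ}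
    (hg : ∀ x, m ≤ g x ∧ g x ≤ m + 2) (hd : ∀ x y, d x - d y ≤ 1)
    (hs : ∑ x, g x = ∑ x, d x) :
    ∑ x, (g x ^ 2 - d x ^ 2) =
      2 * (min (Finset.univ.filter fun x => g x = m + 2).card
        (Finset.univ.filter fun x => g x = m).card : ℕ) := by
  set P := (Finset.univ.filter fun x => g x = m + 2).card with hP
  set Q := (Finset.univ.filter fun x => g x = m).card with hQ
  have hP' : (P : ℤ) = ∑ x, if g x = m + 2 then 1 else 0 := by simp [hP]
  have hQ' : (Q : ℤ) = ∑ x, if g x = m then 1 else 0 := by simp [hQ]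
  have hPQ : ∑ x, (g x - (m + 1)) = P - Q := by
    rw [hP', hQ', ← Finset.sum_sub_distrib]
    refine Finset.sum_congr rfl fun x _ => ?_
    have := hg x
    split_ifs <;> omega
  rcases le_total P Q with h | h
  · rw [min_eq_left h, sum_sq_sub_sq_of_balanced hd hs (n := m)
      (Finset.sum_nonneg fun x _ => by have := hg x; omega) (by omega), hP', Finset.mul_sum]
    refine Finset.sum_congr rfl fun x _ => ?_
    obtain h' | h' | h' : g x = m ∨ g x = m + 1 ∨ g x = m + 2 := by have := hg x; omega
    all_goals simp [h']
  · rw [min_eq_right h, sum_sq_sub_sq_of_balanced hd hs (n := m + 1) (by omega)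
      (Finset.sum_nonpos fun x _ => by have := hg x; omega), hQ', Finset.mul_sum]
    refine Finset.sum_congr rfl fun x _ => ?_
    obtain h' | h' | h' : g x = m ∨ g x = m + 1 ∨ g x = m + 2 := by have := hg x; omega
    all_goals simp [h']

theorem min_ncard_eq {g : ι → ℤ} (hg : ∀ x y, g x - g y ≤ 2) {x₀ : ι} (hx₀ : ∀ x, g x₀ ≤ g x) :
    min (Set.ncard {x | ∃ y, g x - g y = 2}) (Set.ncard {y | ∃ x, g x - g y = 2}) =
      min (Finset.univ.filter fun x => g x = g x₀ + 2).card
        (Finset.univ.filter fun x => g x = g x₀).card := by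
  have hX : {x | ∃ y, g x - g y = 2} =
      (Finset.univ.filter fun x => g x = g x₀ + 2 : Finset ι) := by
    ext x
    simp only [Set.mem_ofPred_eq, Finset.coe_filter, Finset.mem_univ, true_and]
    refine ⟨fun ⟨y, hy⟩ => ?_, fun h => ⟨x₀, by omega⟩⟩
    have := hg x x₀
    have := hx₀ y
    omega
  rw [hX, Set.ncard_coe_finset]
  by_cases h : ∃ z, g z = g x₀ + 2
  · obtain ⟨z, hz⟩ := h
    have hY : {y | ∃ x, g x - g y = 2} =
        (Finset.univ.filter fun x => g x = g x₀ : Finset ι) := by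
      ext y
      simp only [Set.mem_ofPred_eq, Finset.coe_filter, Finset.mem_univ, true_and]
      refine ⟨fun ⟨x, hx⟩ => ?_, fun h => ⟨z, by omega⟩⟩
      have := hg x x₀
      have := hx₀ y
      omega
    rw [hY, Set.ncard_coe_finset]
  · push Not at h
    simp [Finset.filter_eq_empty_iff.2 fun x _ => h x]

end Balanced

theorem resCard_range_sub_le {e : ℕ} [NeZero e] (s t : ℕ) (x y : ZMod e) :
    ((resCard e (Finset.range s) x : ℤ) - resCard e (Finset.range t) x) -
      ((resCard e (Finset.range s) y : ℤ) - resCard e (Finset.range t) y) ≤ 1 := by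
  simp only [resCard_range, count_natCast_eq]
  push_cast
  split_ifs <;> omega

theorem stmt10 (e : ℕ) (he : 2 ≤ e) (κ : Fin 2 → ZMod e) (lam : Fin 2 → ℕ → ℕ)
    (hlam : IsBipartition lam) (hbicore : IsBicore e lam)
    (hgam : ∀ k₁ k₂ : ℕ, IsBicharge e κ lam k₁ k₂ →
      ∀ x y : ZMod e, gamma e lam k₁ k₂ x - gamma e lam k₁ k₂ y ≤ 2) :
    ∀ k₁ k₂ : ℕ, IsBicharge e κ lam k₁ k₂ →
      wt e κ lam =
        ((min (Set.ncard {x : ZMod e | ∃ y, gamma e lam k₁ k₂ x - gamma e lam k₁ k₂ y = 2})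
          (Set.ncard {y : ZMod e | ∃ x, gamma e lam k₁ k₂ x - gamma e lam k₁ k₂ y = 2}) : ℕ) :
            ℚ) := by
  intro k₁ k₂ hch
  have hg := hgam k₁ k₂ hch
  obtain ⟨hκ₁, hκ₂, hk₁, hk₂⟩ := hch
  have : NeZero e := ⟨by omega⟩
  obtain ⟨x₀, hx₀⟩ := Finite.exists_min (gamma e lam k₁ k₂)
  have hwt := two_mul_wt (k := ![k₁, k₂]) hlam hbicore
    (Fin.forall_fin_two.2 ⟨hκ₁, hκ₂⟩) (Fin.forall_fin_two.2 ⟨hk₁, hk₂⟩)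
  have hsum : ∑ x, gamma e lam k₁ k₂ x =
      ∑ x, ((resCard e (Finset.range k₁) x : ℤ) - resCard e (Finset.range k₂) x) := by
    change ∑ x, ((resCard e (betaSet (lam 0) k₁) x : ℤ) - resCard e (betaSet (lam 1) k₂) x) = _
    rw [Finset.sum_sub_distrib, Finset.sum_sub_distrib]
    simp only [← Nat.cast_sum, sum_resCard, card_betaSet (hlam _), Finset.card_range]
  have hmin := sum_sq_sub_sq_eq_two_mul_min
    (fun x => ⟨hx₀ x, by have := hg x x₀; omega⟩) (resCard_range_sub_le k₁ k₂) hsum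
  rw [min_ncard_eq hg hx₀]
  have heq : 2 * wt e κ lam = ((∑ x, (gamma e lam k₁ k₂ x ^ 2 -
      ((resCard e (Finset.range k₁) x : ℤ) - resCard e (Finset.range k₂) x) ^ 2) : ℤ) : ℚ) := hwt
  rw [hmin] at heq
  push_cast at heq ⊢
  linarith

end Wt3
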